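/- Let A be a J-algebra and a, b ∈ A with a˘;a ≤ 1', b˘;b ≤ 1', 1 = a˘;b, and 1 = a;1 = b;1. Let P = (a;b˘)·(b;a˘). Then P;a = b and P;b = a. -/

import Mathlib

/-- A J-algebra: an algebra (A, ·, 0, 1, ;, ˘, 1') satisfying Jónsson's axioms. -/
structure JAlgebra (A : Type*) where
  meet : A → A → A        -- Boolean product ·
  comp : A → A → A        -- relative product ;
  conv : A → A            -- converse ˘
  zero : A                -- 0
  one : A                 -- 1
  ident : A               -- 1'
  massoc : ∀ x y z, meet x (meet y z) = meet (meet x y) z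
  mcomm : ∀ x y, meet x y = meet y x
  midem : ∀ x, meet x x = x
  cassoc : ∀ x y z, comp x (comp y z) = comp (comp x y) z
  cid : ∀ x, comp x ident = x
  semidist : ∀ x y z, comp (meet x y) z = meet (comp (meet x y) z) (comp y z)
  convconv : ∀ x, conv (conv x) = x
  convcomp : ∀ x y, conv (comp x y) = comp (conv y) (conv x)
  convmeet : ∀ x y, conv (meet x y) = meet (conv x) (conv y)
  rot : ∀ x y z, meet (comp x y) z =
    meet (comp (meet (comp z (conv y)) x) (meet y (comp (conv x) z))) z
  zbot : ∀ x, meet zero x = zero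
  otop : ∀ x, meet x one = x
  comp_zero : ∀ x, comp x zero = zero

/-- x ≤ y iff x·y = x. -/
def JAlgebra.le {A : Type*} (J : JAlgebra A) (x y : A) : Prop := J.meet x y = x

/-- x is functional iff x˘;x ≤ 1'. -/
def JAlgebra.Functional {A : Type*} (J : JAlgebra A) (x : A) : Prop :=
  J.le (J.comp (J.conv x) x) J.ident

/-- x is permutational iff x;x˘ = 1' = x˘;x. -/
def JAlgebra.Permutational {A : Type*} (J : JAlgebra A) (x : A) : Prop :=
  J.comp x (J.conv x) = J.ident ∧ J.comp (J.conv x) x = J.ident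

namespace JAlgebra

variable {A : Type*} (J : JAlgebra A)

theorem le_antisymm {x y : A} (h : J.le x y) (h' : J.le y x) : x = y :=
  h.symm.trans ((J.mcomm x y).trans h')

theorem le_trans {x y z : A} (h : J.le x y) (h' : J.le y z) : J.le x z := by
  unfold le at *
  rw [← h, ← J.massoc, h']

theorem meet_le_left (x y : A) : J.le (J.meet x y) x := by
  unfold le
  rw [J.mcomm, J.massoc, J.midem]

theorem meet_le_right (x y : A) : J.le (J.meet x y) y := by
  rw [J.mcomm]
  exact J.meet_le_left y x

theorem conv_mono {x y : A} (h : J.le x y) : J.le (J.conv x) (J.conv y) := by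
  unfold le at *
  rw [← J.convmeet, h]

theorem comp_mono_left {x y : A} (h : J.le x y) (z : A) :
    J.le (J.comp x z) (J.comp y z) := by
  have hz := J.semidist x y z
  rw [h] at hz
  exact hz.symm

theorem comp_mono_right (x : A) {y z : A} (h : J.le y z) :
    J.le (J.comp x y) (J.comp x z) := by
  have hx := J.conv_mono (J.comp_mono_left (J.conv_mono h) (J.conv x))
  simpa only [J.convcomp, J.convconv] using hx

theorem conv_one : J.conv J.one = J.one := by
  have h := J.convmeet (J.conv J.one) J.one
  rw [J.otop, J.convconv, J.mcomm, J.otop] at h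
  exact h.symm

/-- The modular law. -/
theorem comp_meet_le (x y z : A) :
    J.le (J.meet (J.comp x y) z) (J.comp (J.meet x (J.comp z (J.conv y))) y) := by
  rw [J.rot, J.mcomm x]
  exact J.le_trans (J.meet_le_left _ _) (J.comp_mono_right _ (J.meet_le_left _ _))

theorem meet_comp_eq {a b : A} (ha : J.Functional a)
    (hba : J.comp (J.conv b) a = J.one) (hD : J.comp a J.one = J.one) :
    J.comp (J.meet (J.comp a (J.conv b)) (J.comp b (J.conv a))) a = b := by
  apply J.le_antisymm
  · have h := J.comp_mono_right b ha
    rw [J.cassoc, J.cid] at h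
    exact J.le_trans (J.comp_mono_left (J.meet_le_right _ _) a) h
  · have h := J.comp_meet_le (J.comp a (J.conv b)) a b
    rwa [← J.cassoc, hba, hD, J.mcomm J.one, J.otop] at h

end JAlgebra

/-- If a, b satisfy (Q) and (D), then P = (a;b˘)·(b;a˘) swaps a and b:
P;a = b and P;b = a. -/
theorem swap_P {A : Type*} (J : JAlgebra A) (a b : A)
    (ha : J.le (J.comp (J.conv a) a) J.ident)
    (hb : J.le (J.comp (J.conv b) b) J.ident)
    (hQ : J.one = J.comp (J.conv a) b)
    (hDa : J.one = J.comp a J.one)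
    (hDb : J.one = J.comp b J.one) :
    J.comp (J.meet (J.comp a (J.conv b)) (J.comp b (J.conv a))) a = b ∧
    J.comp (J.meet (J.comp a (J.conv b)) (J.comp b (J.conv a))) b = a := by
  have hba : J.comp (J.conv b) a = J.one := by
    rw [← J.conv_one, hQ, J.convcomp, J.convconv]
  refine ⟨J.meet_comp_eq ha hba hDa.symm, ?_⟩
  rw [J.mcomm]
  exact J.meet_comp_eq hb hQ.symm hDb.symm
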